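/- Let θ ∈ ℝ and δ(ζ) = 3/2 − 2ζ + ζ²/2. Define the entire function ℓ̃(ζ) = ζ ( (3−ζ)/2 + (θ + 1/2) δ(ζ) ) e^{−θ δ(ζ)}. Then: (i) for all ζ ∈ ℂ with ζ ≠ 1, ℓ̃(ζ) = δ(ζ) ζ ( 1/(1−ζ) + θ + 1/2 ) e^{−θ δ(ζ)}, i.e. ℓ̃ is the analytic continuation of the paper's kernel function ℓ across its removable singularity at ζ = 1; (ii) ℓ̃(1) = 1; and (iii) ℓ̃′(1) = 0. Consequently there exist a constant c(θ) ∈ ℂ and an entire function r such that ℓ̃(ζ) = 1 + c(θ)(1−ζ)² + (1−ζ)³ r(ζ). -/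

import Mathlib

open Complex

/-- The BDF2 generating function `δ(ζ) = 3/2 - 2ζ + ζ²/2`. -/
noncomputable def bdf2 (ζ : ℂ) : ℂ := 3 / 2 - 2 * ζ + ζ ^ 2 / 2

/-- The entire extension `ℓ̃(ζ) = ζ((3-ζ)/2 + (θ+1/2)δ(ζ)) e^{-θδ(ζ)}` of the paper's
kernel `ℓ(ζ) = δ(ζ) ζ (1/(1-ζ) + θ + 1/2) e^{-θδ(ζ)}`. -/
noncomputable def ellTilde (θ : ℝ) (ζ : ℂ) : ℂ :=
  ζ * ((3 - ζ) / 2 + ((θ : ℂ) + 1 / 2) * bdf2 ζ) * Complex.exp (-(θ : ℂ) * bdf2 ζ)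

lemma hasDerivAt_bdf2 (ζ : ℂ) : HasDerivAt bdf2 (ζ - 2) ζ := by
  have h := (((hasDerivAt_id ζ).const_mul 2).const_sub (3 / 2)).add
    (((hasDerivAt_id ζ).pow 2).div_const 2)
  refine h.congr_deriv ?_
  simp
  ring

lemma differentiable_bdf2 : Differentiable ℂ bdf2 :=
  fun ζ => (hasDerivAt_bdf2 ζ).differentiableAt

lemma bdf2_one : bdf2 1 = 0 := by
  norm_num [bdf2]

lemma differentiable_ellTilde (θ : ℝ) : Differentiable ℂ (ellTilde θ) := by
  have h := differentiable_bdf2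
  unfold ellTilde
  fun_prop

lemma hasDerivAt_ellTilde_one (θ : ℝ) : HasDerivAt (ellTilde θ) 0 1 := by
  have hδ := hasDerivAt_bdf2 1
  have h := ((hasDerivAt_id (1 : ℂ)).mul ((((hasDerivAt_id (1 : ℂ)).const_sub 3).div_const 2).add
    (hδ.const_mul ((θ : ℂ) + 1 / 2)))).mul (hδ.const_mul (-(θ : ℂ))).cexp
  refine h.congr_deriv ?_
  simp [bdf2_one]
  ring

lemma differentiable_dslope {f : ℂ → ℂ} (hf : Differentiable ℂ f) (a : ℂ) :
    Differentiable ℂ (dslope f a) := by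
  rw [← differentiableOn_univ] at hf ⊢
  exact (Complex.differentiableOn_dslope Filter.univ_mem).mpr hf

/-- Second-order Taylor expansion of an entire function with entire remainder. -/
lemma exists_entire_taylor_two {f : ℂ → ℂ} (hf : Differentiable ℂ f) (a : ℂ) :
    ∃ c : ℂ, ∃ r : ℂ → ℂ, Differentiable ℂ r ∧
      ∀ z : ℂ, f z = f a + deriv f a * (z - a) + c * (z - a) ^ 2 + (z - a) ^ 3 * r z := by
  have expand (g : ℂ → ℂ) (z : ℂ) : g z = g a + (z - a) * dslope g a z := by
    rw [← smul_eq_mul, sub_smul_dslope]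
    ring
  refine ⟨dslope (dslope f a) a a, _,
    differentiable_dslope (differentiable_dslope (differentiable_dslope hf a) a) a, fun z => ?_⟩
  rw [expand f z, expand (dslope f a) z, expand (dslope (dslope f a) a) z,
    dslope_same f a]
  ring

/-- `ℓ̃` agrees with `ℓ` away from `ζ = 1`, satisfies `ℓ̃(1) = 1`, `ℓ̃′(1) = 0`, and hence
has the expansion `ℓ̃(ζ) = 1 + c(θ)(1-ζ)² + (1-ζ)³ r(ζ)` with `r` entire. -/
theorem ellTilde_properties (θ : ℝ) :
    (∀ ζ : ℂ, ζ ≠ 1 →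
      ellTilde θ ζ =
        bdf2 ζ * ζ * (1 / (1 - ζ) + (θ : ℂ) + 1 / 2) * Complex.exp (-(θ : ℂ) * bdf2 ζ)) ∧
    ellTilde θ 1 = 1 ∧
    deriv (ellTilde θ) 1 = 0 ∧
    ∃ c : ℂ, ∃ r : ℂ → ℂ, Differentiable ℂ r ∧
      ∀ ζ : ℂ, ellTilde θ ζ = 1 + c * (1 - ζ) ^ 2 + (1 - ζ) ^ 3 * r ζ := by
  have one : ellTilde θ 1 = 1 := by
    norm_num [ellTilde, bdf2_one]
  refine ⟨fun ζ hζ => ?_, one, (hasDerivAt_ellTilde_one θ).deriv, ?_⟩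
  · have h : 1 - ζ ≠ 0 := sub_ne_zero.mpr hζ.symm
    unfold ellTilde
    congr 1
    unfold bdf2
    field_simp
    ring
  · obtain ⟨c, r, hr, h⟩ := exists_entire_taylor_two (differentiable_ellTilde θ) 1
    refine ⟨c, fun z => -r z, hr.neg, fun ζ => ?_⟩
    rw [h ζ, one, (hasDerivAt_ellTilde_one θ).deriv]
    ring
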